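/- If A is a superlow, jump-traceable set, then every A-partial computable function has a restrained A-approximation; conversely, if every A-partial computable function has a restrained A-approximation, then A is superlow and jump-traceable. -/

import Mathlib

/-- The first `k` bits of `A` as a finite string. -/
def initSeg (A : ℕ → Bool) (k : ℕ) : List Bool :=
  List.ofFn fun i : Fin k => A i
/-- A set `C ⊆ α` is computably enumerable. -/
def CEset {α : Type} [Primcodable α] (C : Set α) : Prop :=
  ∃ f : α →. Unit, Partrec f ∧ ∀ x, x ∈ C ↔ (f x).Dom

/-- A set `C ⊆ α` is computably enumerable relative to the oracle `A ∈ 2^ω`: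
some partial computable functional applied to initial segments of `A` has domain `C`. -/
def CeIn {α : Type} [Primcodable α] (A : ℕ → Bool) (C : Set α) : Prop :=
  ∃ Γ : List Bool → α →. Unit, Partrec₂ Γ ∧
    ∀ x, x ∈ C ↔ ∃ k, (Γ (initSeg A k) x).Dom

/-- The function `g` changes value at most `b` many times. -/
def ChangesBdd (g : ℕ → ℕ) (b : ℕ) : Prop :=
  ∀ F : Finset ℕ, (∀ s ∈ F, g (s + 1) ≠ g s) → F.card ≤ b

/-- A set `C ⊆ ℕ` is ω-c.e.: it has a computable approximation whose number of
mind changes is bounded by a computable function. -/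
def OmegaCESet (C : Set ℕ) : Prop :=
  ∃ g : ℕ → ℕ → Bool, ∃ b : ℕ → ℕ, Computable₂ g ∧ Computable b ∧
    (∀ x, ∃ s₀, ∀ s ≥ s₀, (g x s = true ↔ x ∈ C)) ∧
    (∀ x, ∀ F : Finset ℕ, (∀ s ∈ F, g x (s + 1) ≠ g x s) → F.card ≤ b x)

/-- `A` is superlow: every set c.e. relative to `A` is ω-c.e.
(equivalently, `A'` is ω-c.e.). -/
def Superlow (A : ℕ → Bool) : Prop :=
  ∀ C : Set ℕ, CeIn A C → OmegaCESet C

/-- The domain of a partial computable functional is an antichain of strings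
(in each input `x`): comparable strings in the domain coincide. -/
def UseConsistent (Γ : List Bool → ℕ →. ℕ) : Prop :=
  ∀ τ τ' x, (Γ τ x).Dom → (Γ τ' x).Dom → τ <+: τ' → τ = τ'

/-- The functional `Γ` evaluated on oracle `A` equals the partial function `ψ`. -/
def EvalsTo (Γ : List Bool → ℕ →. ℕ) (A : ℕ → Bool) (ψ : ℕ →. ℕ) : Prop :=
  ∀ x y, y ∈ ψ x ↔ ∃ k, y ∈ Γ (initSeg A k) x

/-- `ψ` is an `A`-partial computable function: `ψ = Γ^A` for some
partial computable functional `Γ`. -/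
def APartialComputable (A : ℕ → Bool) (ψ : ℕ →. ℕ) : Prop :=
  ∃ Γ : List Bool → ℕ →. ℕ, Partrec₂ Γ ∧ UseConsistent Γ ∧ EvalsTo Γ A ψ

/-- An order function: computable, nondecreasing, unbounded, positive at 0. -/
def IsOrderFunction (h : ℕ → ℕ) : Prop :=
  Computable h ∧ Monotone h ∧ (∀ n, ∃ x, n ≤ h x) ∧ 0 < h 0

/-- `T` is a (uniformly c.e.) trace for the partial function `ψ`. -/
def IsTrace (ψ : ℕ →. ℕ) (T : ℕ → Finset ℕ) : Prop :=
  CEset {p : ℕ × ℕ | p.2 ∈ T p.1} ∧ ∀ x y, y ∈ ψ x → y ∈ T x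

/-- `A` is jump-traceable: every `A`-partial computable function has a
c.e. trace bounded by some order function. -/
def JumpTraceable (A : ℕ → Bool) : Prop :=
  ∀ ψ : ℕ →. ℕ, APartialComputable A ψ →
    ∃ h T, IsOrderFunction h ∧ IsTrace ψ T ∧ ∀ x, (T x).card ≤ h x

/-- `A` is strongly jump-traceable: for every order function `h`, every
`A`-partial computable function has a c.e. trace bounded by `h`. -/
def StronglyJumpTraceable (A : ℕ → Bool) : Prop :=
  ∀ h : ℕ → ℕ, IsOrderFunction h → ∀ ψ : ℕ →. ℕ, APartialComputable A ψ →
    ∃ T, IsTrace ψ T ∧ ∀ x, (T x).card ≤ h x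

/-- `ψ` has a restrained `A`-approximation: there are a computable approximation
`⟨A_s⟩` to `A` and a computable stagewise enumeration `⟨Γ_s⟩` of a partial
computable functional `Γ` with `Γ^A = ψ`, together with a computable function
`g` such that for each `x`, at most `g(x)` stages `s` have a convergent
computation `Γ^A(x)[s]` destroyed at stage `s+1`. -/
def RestrainedApprox (A : ℕ → Bool) (ψ : ℕ →. ℕ) : Prop :=
  ∃ (As : ℕ → ℕ → Bool) (Γs : ℕ × List Bool × ℕ → Option ℕ)
    (Γ : List Bool → ℕ →. ℕ) (g : ℕ → ℕ),
    Computable₂ As ∧ Computable Γs ∧ Computable g ∧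
    -- `⟨A_s⟩` is a computable approximation to `A`:
    (∀ n, ∃ s₀, ∀ s ≥ s₀, As s n = A n) ∧
    -- `⟨Γ_s⟩` is a monotone enumeration of (the graph of) `Γ`:
    (∀ s τ x y, Γs (s, τ, x) = some y → Γs (s + 1, τ, x) = some y) ∧
    (∀ τ x y, y ∈ Γ τ x ↔ ∃ s, Γs (s, τ, x) = some y) ∧
    UseConsistent Γ ∧ EvalsTo Γ A ψ ∧
    -- at most `g x` stages destroy a convergent computation `Γ^A(x)[s]`:
    (∀ x, ∀ F : Finset ℕ,
      (∀ s ∈ F, ∃ τ y, Γs (s, τ, x) = some y ∧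
        initSeg (As s) τ.length = τ ∧ initSeg (As (s + 1)) τ.length ≠ τ) →
      F.card ≤ g x)

section Computability

variable {α β σ : Type*} [Primcodable α] [Primcodable β] [Primcodable σ]

theorem Computable.decide_eq [DecidableEq β] {f g : α → β} (hf : Computable f)
    (hg : Computable g) : Computable fun a => decide (f a = g a) :=
  (Primrec.eq (α := β)).decide.to_comp.comp hf hg

theorem Computable.decide_lt {f g : α → ℕ} (hf : Computable f) (hg : Computable g) :
    Computable fun a => decide (f a < g a) :=
  Primrec.nat_lt.decide.to_comp.comp hf hg

theorem Computable.bool_and {f g : α → Bool} (hf : Computable f) (hg : Computable g) :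
    Computable fun a => f a && g a :=
  Primrec.and.to_comp.comp hf hg

theorem Computable.bool_not {f : α → Bool} (hf : Computable f) : Computable fun a => !f a :=
  Primrec.not.to_comp.comp hf

theorem Computable.isSome {f : α → Option β} (hf : Computable f) :
    Computable fun a => (f a).isSome :=
  Primrec.option_isSome.to_comp.comp hf

theorem Computable.orElse {f g : α → Option β} (hf : Computable f) (hg : Computable g) :
    Computable fun a => (f a <|> g a) :=
  Primrec.option_orElse.to_comp.comp hf hg

theorem Computable.nat_add {f g : α → ℕ} (hf : Computable f) (hg : Computable g) :
    Computable fun a => f a + g a :=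
  Primrec.nat_add.to_comp.comp hf hg

theorem Computable.nat_pair {f g : α → ℕ} (hf : Computable f) (hg : Computable g) :
    Computable fun a => Nat.pair (f a) (g a) :=
  Primrec₂.natPair.to_comp.comp hf hg

theorem Computable.sum_range {f : α → ℕ → ℕ} {n : α → ℕ} (hf : Computable₂ f)
    (hn : Computable n) : Computable fun a => ∑ i ∈ Finset.range (n a), f a i := by
  refine (Computable.nat_rec (h := fun a p => p.2 + f a p.1) hn (Computable.const 0)
    (Computable.nat_add (snd.comp snd) (hf.comp fst (fst.comp snd))).to₂).of_eq fun a => ?_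
  induction n a with
  | zero => rfl
  | succ k ih => rw [Finset.sum_range_succ, ← ih]

/-- The value of the first `u i` with `i < n` that is not `none`. -/
def firstSome {γ : Type*} (u : ℕ → Option γ) : ℕ → Option γ
  | 0 => none
  | n + 1 => firstSome u n <|> u n

theorem Computable.firstSome {u : α → ℕ → Option β} {n : α → ℕ} (hu : Computable₂ u)
    (hn : Computable n) : Computable fun a => firstSome (u a) (n a) := by
  refine (Computable.nat_rec (h := fun a p => (p.2 <|> u a p.1)) hn (Computable.const none)
    (Computable.orElse (snd.comp snd) (hu.comp fst (fst.comp snd))).to₂).of_eq fun a => ?_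
  induction n a with
  | zero => rfl
  | succ k ih => simp only [_root_.firstSome, ← ih]

theorem Computable.initSeg {B : α → ℕ → Bool} {k : α → ℕ} (hB : Computable₂ B)
    (hk : Computable k) : Computable fun a => initSeg (B a) (k a) := by
  refine (Computable.nat_rec (h := fun a p => p.2 ++ [B a p.1]) hk (Computable.const [])
    (Computable.list_concat.comp (snd.comp snd) (hB.comp fst (fst.comp snd))).to₂).of_eq
    fun a => ?_
  induction k a with
  | zero => rfl
  | succ k ih => rw [_root_.initSeg, List.ofFn_succ_last]; simpa [_root_.initSeg] using ih

end Computability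

section FirstSome

variable {γ : Type*} {u v : ℕ → Option γ}

theorem firstSome_congr {n : ℕ} (h : ∀ i < n, u i = v i) : firstSome u n = firstSome v n := by
  induction n with
  | zero => rfl
  | succ n ih => rw [firstSome, firstSome, ih fun i hi => h i (by omega), h n (by omega)]

theorem exists_of_firstSome {n : ℕ} {y : γ} (h : firstSome u n = some y) :
    ∃ i < n, u i = some y := by
  induction n with
  | zero => simp [firstSome] at h
  | succ n ih =>
    rw [firstSome] at h
    cases h' : firstSome u n with
    | none => exact ⟨n, by omega, by simpa [h'] using h⟩
    | some z =>
      obtain ⟨i, hi, hi'⟩ := ih (by simpa [h'] using h)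
      exact ⟨i, by omega, hi'⟩

theorem isSome_firstSome {n i : ℕ} (hi : i < n) (h : (u i).isSome) : (firstSome u n).isSome := by
  induction n with
  | zero => omega
  | succ n ih =>
    rw [firstSome]
    rcases Nat.lt_succ_iff_lt_or_eq.1 hi with hi | rfl
    · simp [ih hi]
    · simp [h]

theorem firstSome_eq_of_unique {n i : ℕ} {y : γ} (hi : i < n) (h : (u i).isSome)
    (huniq : ∀ j < n, ∀ z, u j = some z → z = y) : firstSome u n = some y := by
  obtain ⟨z, hz⟩ := Option.isSome_iff_exists.1 (isSome_firstSome hi h)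
  obtain ⟨j, hj, hj'⟩ := exists_of_firstSome hz
  rw [hz, huniq j hj z hj']

theorem firstSome_eq_of_le {m n : ℕ} (hmn : m ≤ n) (h : (firstSome u m).isSome) :
    firstSome u n = firstSome u m := by
  induction n, hmn using Nat.le_induction with
  | base => rfl
  | succ n _ ih =>
    obtain ⟨z, hz⟩ := Option.isSome_iff_exists.1 h
    simp [firstSome, ih, hz]

end FirstSome

section InitSeg

variable {A B : ℕ → Bool}

@[simp]
theorem length_initSeg (k : ℕ) : (initSeg A k).length = k := by simp [initSeg]

theorem getElem?_initSeg (k m : ℕ) :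
    (initSeg A k)[m]? = if m < k then some (A m) else none := by
  simp [initSeg, List.getElem?_ofFn]

theorem initSeg_eq_iff {k : ℕ} : initSeg A k = initSeg B k ↔ ∀ m < k, A m = B m := by
  constructor
  · intro h m hm
    have := congrArg (·[m]?) h
    simpa only [getElem?_initSeg, hm, if_true, Option.some.injEq] using this
  · intro h
    refine List.ext_getElem? fun m => ?_
    rw [getElem?_initSeg, getElem?_initSeg]
    split_ifs with hm
    · rw [h m hm]
    · rfl

theorem take_initSeg {j k : ℕ} (h : j ≤ k) : (initSeg A k).take j = initSeg A j := by
  refine List.ext_getElem? fun m => ?_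
  grind [getElem?_initSeg]

theorem initSeg_prefix_of_le {j k : ℕ} (h : j ≤ k) : initSeg A j <+: initSeg A k := by
  rw [List.prefix_iff_eq_take, length_initSeg, take_initSeg h]

end InitSeg

section Staged

/-- A stagewise computation: once a value appears, it persists. -/
def Staged {γ : Type*} (f : ℕ → Option γ) : Prop :=
  ∀ s y, f s = some y → f (s + 1) = some y

variable {γ : Type*} {f : ℕ → Option γ}

theorem Staged.le (hf : Staged f) {s t : ℕ} (hst : s ≤ t) {y : γ} (h : f s = some y) :
    f t = some y := by
  induction t, hst using Nat.le_induction with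
  | base => exact h
  | succ t _ ih => exact hf t y ih

theorem Staged.unique (hf : Staged f) {s t : ℕ} {y z : γ} (hy : f s = some y)
    (hz : f t = some z) : y = z := by
  have h := (hf.le (le_max_left s t) hy).symm.trans (hf.le (le_max_right s t) hz)
  simpa using h

theorem Staged.mem_rfindOpt (hf : Staged f) {y : γ} :
    y ∈ Nat.rfindOpt f ↔ ∃ s, f s = some y := by
  rw [Nat.rfindOpt_mono (fun hmn h => hf.le hmn h)]
  rfl

theorem Partrec.exists_staged {α σ : Type*} [Primcodable α] [Primcodable σ] {f : α →. σ}
    (hf : Partrec f) : ∃ F : α → ℕ → Option σ, Computable₂ F ∧ (∀ a, Staged (F a)) ∧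
      ∀ a y, y ∈ f a ↔ ∃ s, F a s = some y := by
  obtain ⟨c, hc⟩ := Nat.Partrec.Code.exists_code.1 hf
  refine ⟨fun a s => (c.evaln s (Encodable.encode a)).bind Encodable.decode, ?_, ?_, ?_⟩
  · refine Computable.option_bind ?_ (Computable.decode.comp Computable.snd).to₂
    exact Nat.Partrec.Code.primrec_evaln.to_comp.comp
      ((Computable.snd.pair (Computable.const c)).pair (Computable.encode.comp Computable.fst))
  · intro a s y h
    obtain ⟨n, hn, hn'⟩ := Option.bind_eq_some_iff.1 h
    exact Option.bind_eq_some_iff.2 ⟨n, Nat.Partrec.Code.evaln_mono (Nat.le_succ s) hn, hn'⟩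
  · intro a y
    have key : ∀ n, n ∈ c.eval (Encodable.encode a) ↔ ∃ y ∈ f a, Encodable.encode y = n := by
      intro n
      simp [hc]
    constructor
    · intro hy
      obtain ⟨s, hs⟩ := Nat.Partrec.Code.evaln_complete.1 ((key _).2 ⟨y, hy, rfl⟩)
      exact ⟨s, by simp [Option.mem_def.1 hs]⟩
    · rintro ⟨s, hs⟩
      obtain ⟨n, hn, hn'⟩ := Option.bind_eq_some_iff.1 hs
      obtain ⟨z, hz, rfl⟩ := (key _).1 (Nat.Partrec.Code.evaln_sound hn)
      simp only [Encodable.encodek, Option.some.injEq] at hn'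
      exact hn' ▸ hz

theorem CEset.of_exists {α : Type} [Primcodable α] {D : α → ℕ → Bool} (hD : Computable₂ D)
    {C : Set α} (hC : ∀ a, a ∈ C ↔ ∃ n, D a n = true) : CEset C := by
  refine ⟨fun a => (Nat.rfind fun n => Part.some (D a n)).map fun _ => (),
    (Partrec.rfind hD.partrec₂).map (Computable.const ()).to₂, fun a => ?_⟩
  rw [hC]
  constructor
  · rintro ⟨n, hn⟩
    exact Nat.rfind_dom.2 ⟨n, by simp [hn], fun _ => trivial⟩
  · intro h
    obtain ⟨n, hn, -⟩ := Nat.rfind_dom.1 h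
    obtain ⟨_, hn⟩ := hn
    exact ⟨n, hn⟩

end Staged

section Bound

/-- The event `P` happens at no more than `b` stages. -/
def HappensAtMost (P : ℕ → Prop) (b : ℕ) : Prop :=
  ∀ F : Finset ℕ, (∀ s ∈ F, P s) → F.card ≤ b

variable {P Q : ℕ → Prop} {a b : ℕ}

theorem HappensAtMost.mono (hQ : HappensAtMost Q b) (h : ∀ s, P s → Q s) : HappensAtMost P b :=
  fun F hF => hQ F fun s hs => h s (hF s hs)

theorem HappensAtMost.or (hP : HappensAtMost P a) (hQ : HappensAtMost Q b) :
    HappensAtMost (fun s => P s ∨ Q s) (a + b) := by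
  classical
  intro F hF
  rw [← Finset.card_filter_add_card_filter_not (s := F) P]
  refine add_le_add (hP _ fun s hs => (Finset.mem_filter.1 hs).2) (hQ _ fun s hs => ?_)
  rw [Finset.mem_filter] at hs
  exact (hF s hs.1).resolve_left hs.2

theorem HappensAtMost.exists_lt {P : ℕ → ℕ → Prop} {b : ℕ → ℕ}
    (h : ∀ i, HappensAtMost (P i) (b i)) (n : ℕ) :
    HappensAtMost (fun s => ∃ i < n, P i s) (∑ i ∈ Finset.range n, b i) := by
  induction n with
  | zero =>
    intro F hF
    simpa [Finset.eq_empty_iff_forall_notMem] using hF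
  | succ n ih =>
    rw [Finset.sum_range_succ]
    refine (ih.or (h n)).mono ?_
    rintro s ⟨i, hi, hs⟩
    rcases Nat.lt_succ_iff_lt_or_eq.1 hi with hi | rfl
    exacts [.inl ⟨i, hi, hs⟩, .inr hs]

theorem Staged.happensAtMost {γ : Type*} {f : ℕ → Option γ} (hf : Staged f) :
    HappensAtMost (fun s => f (s + 1) ≠ f s) 1 := by
  intro F hF
  refine Finset.card_le_one.2 fun s hs t ht => ?_
  have key : ∀ s t, s < t → f (s + 1) ≠ f s → f (t + 1) ≠ f t → False := by
    intro s t hst h1 h2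
    cases h : f (s + 1) with
    | none =>
      cases h' : f s with
      | none => exact h1 (h.trans h'.symm)
      | some y => simp [hf s y h'] at h
    | some y => exact h2 ((hf.le (by omega) h).trans (hf.le hst h).symm)
  rcases lt_trichotomy s t with h | h | h
  exacts [(key s t h (hF s hs) (hF t ht)).elim, h, (key t s h (hF t ht) (hF s hs)).elim]

theorem HappensAtMost.eventually_not (hP : HappensAtMost P b) : ∃ s₀, ∀ s ≥ s₀, ¬ P s := by
  have hfin : {s | P s}.Finite := by
    by_contra hinf
    obtain ⟨F, hF, hcard⟩ := Set.Infinite.exists_subset_card_eq hinf (b + 1)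
    have := hP F fun s hs => hF hs
    omega
  obtain ⟨m, hm⟩ := hfin.bddAbove
  exact ⟨m + 1, fun s hs h => absurd (hm h) (by omega)⟩

theorem HappensAtMost.eventually_const {γ : Type*} {v : ℕ → γ}
    (h : HappensAtMost (fun s => v (s + 1) ≠ v s) b) : ∃ s₀, ∀ s ≥ s₀, v s = v s₀ := by
  obtain ⟨s₀, hs₀⟩ := h.eventually_not
  refine ⟨s₀, fun s hs => ?_⟩
  induction s, hs using Nat.le_induction with
  | base => rfl
  | succ s hs ih => rw [← ih]; exact not_not.1 (hs₀ s hs)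

theorem HappensAtMost.of_range [DecidablePred P]
    (h : ∀ N, ((Finset.range N).filter P).card ≤ b) : HappensAtMost P b := by
  intro F hF
  refine (Finset.card_le_card fun s hs => ?_).trans (h (F.sup id + 1))
  exact Finset.mem_filter.2
    ⟨Finset.mem_range.2 (Nat.lt_succ_of_le (Finset.le_sup (f := id) hs)), hF s hs⟩

/-- Since every value must be lost before a different one is taken, a bound on the losses
yields a bound on the changes. -/
theorem HappensAtMost.changes_of_losses {γ : Type*} {v : ℕ → Option γ}
    (h : HappensAtMost (fun s => (v s).isSome ∧ v (s + 1) ≠ v s) b) :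
    HappensAtMost (fun s => v (s + 1) ≠ v s) (2 * b + 1) := by
  classical
  refine .of_range fun N => ?_
  have key : ((Finset.range N).filter fun s => v (s + 1) ≠ v s).card ≤
      2 * ((Finset.range N).filter fun s => (v s).isSome ∧ v (s + 1) ≠ v s).card +
        (if (v N).isSome then 1 else 0) := by
    induction N with
    | zero => simp
    | succ N ih =>
      rw [Finset.range_add_one, Finset.filter_insert, Finset.filter_insert]
      cases h0 : v N <;> cases h1 : v (N + 1) <;> grind
  have := h ((Finset.range N).filter fun s => (v s).isSome ∧ v (s + 1) ≠ v s)
    fun s hs => (Finset.mem_filter.1 hs).2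
  split_ifs at key <;> omega

theorem HappensAtMost.exists_values {γ : Type*} {v : ℕ → Option γ}
    (h : HappensAtMost (fun s => v (s + 1) ≠ v s) b) :
    ∃ T : Finset γ, T.card ≤ b + 1 ∧ ∀ y, y ∈ T ↔ ∃ s, v s = some y := by
  classical
  obtain ⟨s₀, hconst⟩ := h.eventually_const
  have hcard : ∀ N, ((Finset.range (N + 1)).image v).card ≤
      ((Finset.range N).filter fun s => v (s + 1) ≠ v s).card + 1 := by
    intro N
    induction N with
    | zero => simp
    | succ N ih =>
      rw [Finset.range_add_one, Finset.image_insert, Finset.range_add_one (n := N),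
        Finset.filter_insert, ← Finset.range_add_one]
      split_ifs with hN
      · rw [Finset.card_insert_of_notMem (s := (Finset.range N).filter _) (by simp)]
        exact (Finset.card_insert_le _ _).trans (Nat.add_le_add_right ih 1)
      · rw [not_not.1 hN, Finset.insert_eq_of_mem
          (Finset.mem_image_of_mem v (Finset.self_mem_range_succ N))]
        exact ih
  refine ⟨Finset.eraseNone ((Finset.range (s₀ + 1)).image v), ?_, fun y => ?_⟩
  · refine le_trans ?_ ((hcard s₀).trans (Nat.add_le_add_right (h _ fun s hs =>
      (Finset.mem_filter.1 hs).2) 1))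
    exact Finset.card_eraseNone_le _
  · simp only [Finset.mem_eraseNone, Finset.mem_image, Finset.mem_range]
    constructor
    · rintro ⟨s, -, hs⟩
      exact ⟨s, hs⟩
    · rintro ⟨s, hs⟩
      by_cases hss : s < s₀ + 1
      · exact ⟨s, hss, hs⟩
      · exact ⟨s₀, by omega, (hconst s (by omega)).symm.trans hs⟩

end Bound
section Restrained

variable {A : ℕ → Bool}

/-- The partial function computed by the functional `Γ` with oracle `A`. -/
noncomputable def evalAt (Γ : List Bool → ℕ →. ℕ) (A : ℕ → Bool) : ℕ →. ℕ := fun x =>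
  ⟨∃ k, (Γ (initSeg A k) x).Dom, fun h => (Γ (initSeg A h.choose) x).get h.choose_spec⟩

theorem UseConsistent.unique {Γ : List Bool → ℕ →. ℕ} (hΓ : UseConsistent Γ) {j k x y z : ℕ}
    (hy : y ∈ Γ (initSeg A j) x) (hz : z ∈ Γ (initSeg A k) x) : y = z := by
  have hjk : j = k := by
    rcases le_total j k with h | h
    · simpa using congrArg List.length
        (hΓ _ _ x (Part.dom_iff_mem.2 ⟨y, hy⟩) (Part.dom_iff_mem.2 ⟨z, hz⟩)
          (initSeg_prefix_of_le h))
    · simpa using (congrArg List.length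
        (hΓ _ _ x (Part.dom_iff_mem.2 ⟨z, hz⟩) (Part.dom_iff_mem.2 ⟨y, hy⟩)
          (initSeg_prefix_of_le h))).symm
  subst hjk
  exact Part.mem_unique hy hz

theorem UseConsistent.evalsTo_evalAt {Γ : List Bool → ℕ →. ℕ} (hΓ : UseConsistent Γ) :
    EvalsTo Γ A (evalAt Γ A) := by
  intro x y
  constructor
  · rintro ⟨h, rfl⟩
    exact ⟨h.choose, Part.get_mem h.choose_spec⟩
  · rintro ⟨k, hk⟩
    have h : (evalAt Γ A x).Dom := ⟨k, Part.dom_iff_mem.2 ⟨y, hk⟩⟩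
    exact ⟨h, hΓ.unique (Part.get_mem h.choose_spec) hk⟩

/-- A c.e. operator can be normalised to a functional whose domain is an antichain. -/
theorem CeIn.exists_aPartialComputable {C : Set ℕ} (hC : CeIn A C) :
    ∃ ψ : ℕ →. ℕ, APartialComputable A ψ ∧ ∀ x, x ∈ C ↔ (ψ x).Dom := by
  obtain ⟨Γ, hΓ, hΓC⟩ := hC
  obtain ⟨F, hF, hFs, hFΓ⟩ := Partrec.exists_staged hΓ
  let q : (List Bool × ℕ) → ℕ → Bool := fun p m =>
    (firstSome (fun j => F (p.1.take j, p.2) m) (m + 1)).isSome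
  have hq_iff : ∀ τ x m, q (τ, x) m = true ↔ ∃ j ≤ m, (F (τ.take j, x) m).isSome := by
    intro τ x m
    constructor
    · intro h
      obtain ⟨z, hz⟩ := Option.isSome_iff_exists.1 h
      obtain ⟨j, hj, hj'⟩ := exists_of_firstSome hz
      exact ⟨j, by omega, Option.isSome_iff_exists.2 ⟨z, hj'⟩⟩
    · rintro ⟨j, hj, h⟩
      exact isSome_firstSome (by omega : j < m + 1) h
  have hq : Computable₂ q := by
    refine Computable.isSome (Computable.firstSome ?_ (Computable.succ.comp Computable.snd))
    refine hF.comp (Computable.pair ?_ ?_) (Computable.snd.comp Computable.fst)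
    · exact Primrec.list_take.to_comp.comp Computable.snd
        (Computable.fst.comp (Computable.fst.comp Computable.fst))
    · exact Computable.snd.comp (Computable.fst.comp Computable.fst)
  have hq_mono : ∀ τ x m n, m ≤ n → q (τ, x) m = true → q (τ, x) n = true := by
    intro τ x m n hmn h
    obtain ⟨j, hj, h⟩ := (hq_iff _ _ _).1 h
    obtain ⟨z, hz⟩ := Option.isSome_iff_exists.1 h
    exact (hq_iff _ _ _).2
      ⟨j, hj.trans hmn, Option.isSome_iff_exists.2 ⟨z, (hFs _).le hmn hz⟩⟩
  have hq_take : ∀ τ τ' x m, m ≤ τ.length → τ <+: τ' → q (τ, x) m = q (τ', x) m := by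
    intro τ τ' x m hm h
    rw [Bool.eq_iff_iff, hq_iff, hq_iff]
    refine exists_congr fun j => and_congr_right fun hj => ?_
    rw [List.prefix_iff_eq_take.1 h, List.take_take, min_eq_left (hj.trans hm)]
  let N : List Bool → ℕ → Option ℕ := fun τ x =>
    bif q (τ, x) τ.length && !(decide (0 < τ.length) && q (τ, x) (τ.length - 1)) then some 0
    else none
  have hN : Computable₂ N := by
    have hlen : Computable fun p : List Bool × ℕ => p.1.length :=
      Computable.list_length.comp Computable.fst
    refine Computable.cond (Computable.bool_and ?_ (Computable.bool_not
      (Computable.bool_and ?_ ?_))) (Computable.const _) (Computable.const _)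
    · exact hq.comp Computable.id hlen
    · exact Computable.decide_lt (Computable.const 0) hlen
    · exact hq.comp Computable.id (Computable.pred.comp hlen)
  have hN_dom : ∀ τ x, (N τ x).isSome ↔
      q (τ, x) τ.length = true ∧ ¬ (0 < τ.length ∧ q (τ, x) (τ.length - 1) = true) := by
    intro τ x
    simp only [N]
    cases q (τ, x) τ.length <;> cases q (τ, x) (τ.length - 1) <;>
      by_cases h : 0 < τ.length <;> simp [h]
  let Θ : List Bool → ℕ →. ℕ := fun τ x => (N τ x : Part ℕ)
  have hΘ_dom : ∀ τ x, (Θ τ x).Dom ↔ (N τ x).isSome := by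
    intro τ x
    simp only [Θ]
    cases N τ x <;> simp
  have hΘ_uc : UseConsistent Θ := by
    intro τ τ' x h h' hp
    rw [hΘ_dom, hN_dom] at h h'
    by_contra hne
    have hlt : τ.length < τ'.length :=
      lt_of_le_of_ne hp.length_le fun he => hne (hp.eq_of_length he)
    refine h'.2 ⟨by omega, hq_mono _ _ τ.length _ (by omega) ?_⟩
    rw [← hq_take τ τ' x _ le_rfl hp]
    exact h.1
  refine ⟨evalAt Θ A, ⟨Θ, Computable.ofOption hN, hΘ_uc, hΘ_uc.evalsTo_evalAt⟩, fun x => ?_⟩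
  have hqA : ∀ k m, m ≤ k → q (initSeg A k, x) m = q (initSeg A m, x) m := fun k m hm =>
    (hq_take _ _ x m (by simp) (initSeg_prefix_of_le hm)).symm
  have hxC : x ∈ C ↔ ∃ m, q (initSeg A m, x) m = true := by
    rw [hΓC]
    constructor
    · rintro ⟨k, hk⟩
      obtain ⟨z, hz⟩ := Part.dom_iff_mem.1 hk
      obtain ⟨s, hs⟩ := (hFΓ (initSeg A k, x) z).1 hz
      refine ⟨max k s, (hq_iff _ _ _).2 ⟨k, le_max_left _ _, ?_⟩⟩
      rw [take_initSeg (le_max_left _ _), (hFs _).le (le_max_right k s) hs]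
      rfl
    · rintro ⟨m, hm⟩
      obtain ⟨j, hj, h⟩ := (hq_iff _ _ _).1 hm
      obtain ⟨z, hz⟩ := Option.isSome_iff_exists.1 h
      rw [take_initSeg hj] at hz
      exact ⟨j, Part.dom_iff_mem.2 ⟨z, (hFΓ (initSeg A j, x) z).2 ⟨m, hz⟩⟩⟩
  rw [hxC]
  change _ ↔ ∃ k, (Θ (initSeg A k) x).Dom
  constructor
  · intro h
    classical
    refine ⟨Nat.find h, ?_⟩
    rw [hΘ_dom, hN_dom, length_initSeg]
    refine ⟨Nat.find_spec h, fun ⟨h0, h1⟩ => ?_⟩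
    rw [hqA _ _ (Nat.sub_le _ _)] at h1
    exact Nat.find_min h (by omega) h1
  · rintro ⟨k, hk⟩
    rw [hΘ_dom, hN_dom, length_initSeg] at hk
    exact ⟨k, hk.1⟩

theorem RestrainedApprox.exists_limit {ψ : ℕ →. ℕ} (h : RestrainedApprox A ψ) :
    ∃ (v : ℕ → ℕ → Option ℕ) (b : ℕ → ℕ), Computable₂ v ∧ Computable b ∧
      (∀ x, HappensAtMost (fun s => v x (s + 1) ≠ v x s) (b x)) ∧
      ∀ x y, y ∈ ψ x ↔ ∃ s₀, ∀ s ≥ s₀, v x s = some y := by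
  obtain ⟨As, Γs, Γ, g, hAs, hΓs, hg, hlim, hmono, hΓ, huc, hev, hbd⟩ := h
  let v : ℕ → ℕ → Option ℕ := fun x s =>
    firstSome (fun k => Γs (s, initSeg (As s) k, x)) (s + 1)
  have hstaged : ∀ τ x, Staged fun s => Γs (s, τ, x) := fun τ x s y => hmono s τ x y
  have hv_of : ∀ x s k y, k ≤ s → Γs (s, initSeg (As s) k, x) = some y → v x s = some y := by
    intro x s k y hk hy
    refine firstSome_eq_of_unique (by omega : k < s + 1) (by simp [hy]) fun j _ z hz => ?_
    exact huc.unique (A := As s) (j := j) (k := k) ((hΓ _ _ _).2 ⟨s, hz⟩) ((hΓ _ _ _).2 ⟨s, hy⟩)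
  have hv : Computable₂ v := by
    refine Computable.firstSome (hΓs.comp ?_) (Computable.succ.comp Computable.snd)
    refine Computable.pair (Computable.snd.comp Computable.fst) (Computable.pair ?_ ?_)
    · exact Computable.initSeg
        (hAs.comp (Computable.snd.comp (Computable.fst.comp Computable.fst)) Computable.snd)
        Computable.snd
    · exact Computable.fst.comp Computable.fst
  have hloss : ∀ x, HappensAtMost (fun s => ∃ τ y, Γs (s, τ, x) = some y ∧
      initSeg (As s) τ.length = τ ∧ initSeg (As (s + 1)) τ.length ≠ τ) (g x) := hbd
  have hchanges : ∀ x, HappensAtMost (fun s => v x (s + 1) ≠ v x s) (2 * g x + 1) := by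
    intro x
    refine HappensAtMost.changes_of_losses ((hloss x).mono ?_)
    rintro s ⟨hs, hne⟩
    obtain ⟨y, hy⟩ := Option.isSome_iff_exists.1 hs
    obtain ⟨k, hk, hky⟩ := exists_of_firstSome hy
    refine ⟨initSeg (As s) k, y, hky, by simp, fun heq => hne ?_⟩
    rw [length_initSeg] at heq
    rw [hy]
    exact hv_of x (s + 1) k y (by omega) (by rw [heq]; exact hmono _ _ _ _ hky)
  have hinit : ∀ k, ∀ᶠ s in Filter.atTop, initSeg (As s) k = initSeg A k := by
    intro k
    have : ∀ m ∈ Finset.range k, ∀ᶠ s in Filter.atTop, As s m = A m := fun m _ =>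
      Filter.eventually_atTop.2 (hlim m)
    filter_upwards [(Filter.eventually_all_finset _).2 this] with s hs
    exact initSeg_eq_iff.2 fun m hm => hs m (Finset.mem_range.2 hm)
  refine ⟨v, fun x => 2 * g x + 1, hv, ?_, hchanges, fun x y => ?_⟩
  · exact Computable.succ.comp (Primrec.nat_double.to_comp.comp hg)
  constructor
  · intro hy
    obtain ⟨k, hk⟩ := (hev x y).1 hy
    obtain ⟨s₁, hs₁⟩ := (hΓ _ _ _).1 hk
    refine Filter.eventually_atTop.1 ?_
    filter_upwards [hinit k, Filter.eventually_ge_atTop s₁, Filter.eventually_ge_atTop k]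
      with s hs hs₁s hks
    exact hv_of x s k y hks (by rw [hs]; exact (hstaged _ x).le hs₁s hs₁)
  · rintro ⟨s₀, hs₀⟩
    obtain ⟨s₁, hs₁⟩ := (hloss x).eventually_not
    obtain ⟨k, -, hk⟩ := exists_of_firstSome (hs₀ (max s₀ s₁) (le_max_left _ _))
    have hkeep : ∀ s ≥ max s₀ s₁, initSeg (As s) k = initSeg (As (max s₀ s₁)) k := by
      intro s hs
      induction s, hs using Nat.le_induction with
      | base => rfl
      | succ s hs ih =>
        by_contra hne
        refine hs₁ s (le_of_max_le_right hs) ⟨initSeg (As s) k, y, ?_, by simp, ?_⟩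
        · rw [ih]
          exact (hstaged _ x).le hs hk
        · rw [length_initSeg, ih]
          exact hne
    obtain ⟨s, hs, hs'⟩ := ((hinit k).and (Filter.eventually_ge_atTop (max s₀ s₁))).exists
    refine (hev x y).2 ⟨k, (hΓ _ _ _).2 ⟨max s₀ s₁, ?_⟩⟩
    rw [← hs, hkeep s hs']
    exact hk

theorem superlow_of_restrainedApprox
    (h : ∀ ψ : ℕ →. ℕ, APartialComputable A ψ → RestrainedApprox A ψ) : Superlow A := by
  intro C hC
  obtain ⟨ψ, hψ, hCψ⟩ := hC.exists_aPartialComputable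
  obtain ⟨v, b, hv, hb, hchanges, hlim⟩ := (h ψ hψ).exists_limit
  refine ⟨fun x s => (v x s).isSome, b, Computable.isSome hv, hb, fun x => ?_, fun x => ?_⟩
  · obtain ⟨s₀, hconst⟩ := (hchanges x).eventually_const
    refine ⟨s₀, fun s hs => ?_⟩
    simp only [hCψ, hconst s hs]
    rw [Part.dom_iff_mem, Option.isSome_iff_exists]
    refine exists_congr fun y => ?_
    rw [hlim]
    constructor
    · exact fun hy => ⟨s₀, fun t ht => (hconst t ht).trans hy⟩
    · rintro ⟨t, ht⟩
      rw [← hconst (max s₀ t) (le_max_left _ _)]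
      exact ht _ (le_max_right _ _)
  · exact (hchanges x).mono fun s hs heq => hs (by simp [heq])

theorem jumpTraceable_of_restrainedApprox
    (h : ∀ ψ : ℕ →. ℕ, APartialComputable A ψ → RestrainedApprox A ψ) : JumpTraceable A := by
  intro ψ hψ
  obtain ⟨v, b, hv, hb, hchanges, hlim⟩ := (h ψ hψ).exists_limit
  choose T hTcard hT using fun x => (hchanges x).exists_values
  refine ⟨fun x => (∑ i ∈ Finset.range (x + 1), (b i + 1)) + x, T, ⟨?_, ?_, ?_, ?_⟩,
    ⟨?_, ?_⟩, ?_⟩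
  · refine Computable.nat_add (Computable.sum_range ?_ Computable.succ) Computable.id
    exact Computable.succ.comp (hb.comp Computable.snd)
  · exact fun x y hxy => add_le_add (Finset.sum_le_sum_of_subset
      (Finset.range_mono (Nat.succ_le_succ hxy))) hxy
  · exact fun n => ⟨n, Nat.le_add_left _ _⟩
  · simp
  · refine CEset.of_exists (D := fun p s => decide (v p.1 s = some p.2)) ?_ fun p => ?_
    · exact Computable.decide_eq (hv.comp (Computable.fst.comp Computable.fst) Computable.snd)
        (Computable.option_some.comp (Computable.snd.comp Computable.fst))
    · simp [hT]
  · intro x y hy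
    obtain ⟨s₀, hs₀⟩ := (hlim x y).1 hy
    exact (hT x y).2 ⟨s₀, hs₀ s₀ le_rfl⟩
  · intro x
    refine (hTcard x).trans (le_add_right ?_)
    exact Finset.single_le_sum (f := fun i => b i + 1) (fun _ _ => Nat.zero_le _)
      (Finset.self_mem_range_succ x)

end Restrained

section Enumeration

theorem CEset.exists_enumeration {T : ℕ → Finset ℕ} (hT : CEset {p : ℕ × ℕ | p.2 ∈ T p.1}) :
    ∃ L : ℕ → ℕ → List ℕ, Computable₂ L ∧ (∀ k s, L k s <+: L k (s + 1)) ∧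
      (∀ k s, (L k s).length ≤ (T k).card) ∧ ∀ k y, y ∈ T k ↔ ∃ s, y ∈ L k s := by
  obtain ⟨f, hf, hfT⟩ := hT
  obtain ⟨F, hF, hFs, hFf⟩ := Partrec.exists_staged hf
  have hTF : ∀ k y, y ∈ T k ↔ ∃ t, (F (k, y) t).isSome := by
    intro k y
    rw [show y ∈ T k ↔ (f (k, y)).Dom from hfT (k, y), Part.dom_iff_mem]
    simp only [Option.isSome_iff_exists]
    rw [exists_comm]
    exact exists_congr fun u => hFf _ _
  let step : ℕ → ℕ × List ℕ → List ℕ := fun k p =>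
    bif (F (k, p.1.unpair.1) p.1.unpair.2).isSome &&
      !decide (p.2.idxOf p.1.unpair.1 < p.2.length) then p.2 ++ [p.1.unpair.1] else p.2
  have hstep : Computable₂ step := by
    have hy : Computable fun p : ℕ × ℕ × List ℕ => p.2.1.unpair.1 :=
      Computable.fst.comp (Computable.unpair.comp (Computable.fst.comp Computable.snd))
    have ht : Computable fun p : ℕ × ℕ × List ℕ => p.2.1.unpair.2 :=
      Computable.snd.comp (Computable.unpair.comp (Computable.fst.comp Computable.snd))
    have hl : Computable fun p : ℕ × ℕ × List ℕ => p.2.2 :=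
      Computable.snd.comp Computable.snd
    refine Computable.cond (Computable.bool_and ?_ (Computable.bool_not
      (Computable.decide_lt ?_ (Computable.list_length.comp hl))))
      (Computable.list_concat.comp hl hy) hl
    · exact Computable.isSome (hF.comp (Computable.fst.pair hy) ht)
    · exact Primrec.list_idxOf.to_comp.comp hy hl
  let L : ℕ → ℕ → List ℕ := fun k s =>
    Nat.rec (motive := fun _ => List ℕ) [] (fun s l => step k (s, l)) s
  have hL_succ : ∀ k s, L k (s + 1) = L k s ∨
      L k (s + 1) = L k s ++ [s.unpair.1] ∧ s.unpair.1 ∈ T k ∧ s.unpair.1 ∉ L k s := by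
    intro k s
    change step k (s, L k s) = _ ∨ step k (s, L k s) = _ ∧ _
    simp only [step, List.idxOf_lt_length_iff]
    by_cases h1 : (F (k, s.unpair.1) s.unpair.2).isSome
    · rcases Classical.em (s.unpair.1 ∈ L k s) with h2 | h2
      · simp [h2]
      · exact .inr ⟨by simp [h1, h2], (hTF _ _).2 ⟨_, h1⟩, h2⟩
    · simp [h1]
  have hL_mem : ∀ k s y, y ∈ L k s → y ∈ T k := by
    intro k s y hy
    induction s with
    | zero => simp [L] at hy
    | succ s ih =>
      rcases hL_succ k s with h | ⟨h, hT, -⟩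
      · exact ih (h ▸ hy)
      · rw [h, List.mem_append, List.mem_singleton] at hy
        rcases hy with hy | rfl
        exacts [ih hy, hT]
  have hL_nodup : ∀ k s, (L k s).Nodup := by
    intro k s
    induction s with
    | zero => exact List.nodup_nil
    | succ s ih =>
      rcases hL_succ k s with h | ⟨h, -, hn⟩
      · exact h ▸ ih
      · rw [h, ← List.concat_eq_append]
        exact ih.concat hn
  refine ⟨L, Computable.nat_rec Computable.snd (Computable.const [])
    (hstep.comp (Computable.fst.comp Computable.fst) Computable.snd).to₂, ?_, ?_, ?_⟩
  · intro k s
    rcases hL_succ k s with h | ⟨h, -⟩ <;> rw [h]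
    exact List.prefix_append _ _
  · intro k s
    rw [← List.toFinset_card_of_nodup (hL_nodup k s)]
    exact Finset.card_le_card fun y hy => hL_mem k s y (List.mem_toFinset.1 hy)
  · refine fun k y => ⟨fun hy => ?_, fun ⟨s, hs⟩ => hL_mem k s y hs⟩
    obtain ⟨t, ht⟩ := (hTF k y).1 hy
    refine ⟨Nat.pair y t + 1, ?_⟩
    change y ∈ step k (Nat.pair y t, L k (Nat.pair y t))
    simp only [step, List.idxOf_lt_length_iff, Nat.unpair_pair, ht]
    rcases Classical.em (y ∈ L k (Nat.pair y t)) with h | h <;> simp [h]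

end Enumeration

section Guess

variable {A : ℕ → Bool}

theorem staged_getElem? {γ : Type*} {l : ℕ → List γ} (h : ∀ s, l s <+: l (s + 1)) (n : ℕ) :
    Staged fun s => (l s)[n]? :=
  fun s _ hy => by
    obtain ⟨hn, rfl⟩ := List.getElem?_eq_some_iff.1 hy
    exact List.prefix_iff_getElem?.1 (h s) n hn

/-- Superlowness and jump-traceability together allow to guess effectively, with boundedly many
changes, initial segments of `A` whose lengths are given by a partial computable function. -/
theorem exists_guess (hS : Superlow A) (hJ : JumpTraceable A) {Λ : ℕ → ℕ → Option ℕ}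
    (hΛ : Computable₂ Λ) (hΛs : ∀ k, Staged (Λ k)) :
    ∃ (ρ : ℕ → ℕ → Option (List Bool)) (b : ℕ → ℕ), Computable₂ ρ ∧ Computable b ∧
      (∀ k s σ, ρ k s = some σ → ∃ s', Λ k s' = some σ.length) ∧
      (∀ k s, (ρ k s).isSome → (ρ k (s + 1)).isSome) ∧
      (∀ k s l, Λ k s = some l → ∃ s₀, ∀ s ≥ s₀, ρ k s = some (initSeg A l)) ∧
      ∀ k, HappensAtMost (fun s => ρ k (s + 1) ≠ ρ k s) (b k) := by
  let Θ : List Bool → ℕ →. ℕ := fun τ k => (Nat.rfindOpt (Λ k)).bind fun l =>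
    ((bif decide (l = τ.length) then some (Encodable.encode τ) else none : Option ℕ) : Part ℕ)
  have hΘ_mem : ∀ τ k y, y ∈ Θ τ k ↔ (∃ s, Λ k s = some τ.length) ∧ y = Encodable.encode τ := by
    intro τ k y
    simp only [Θ, Part.mem_bind_iff, (hΛs k).mem_rfindOpt]
    constructor
    · rintro ⟨l, ⟨s, hs⟩, hy⟩
      by_cases h : l = τ.length
      · subst h
        simp only [decide_true, cond_true, Part.coe_some, Part.mem_some_iff] at hy
        exact ⟨⟨s, hs⟩, hy⟩
      · simp [h] at hy
    · rintro ⟨⟨s, hs⟩, rfl⟩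
      exact ⟨_, ⟨s, hs⟩, by simp⟩
  have hΘ : Partrec₂ Θ := by
    have h1 : Partrec fun p : List Bool × ℕ => Nat.rfindOpt (Λ p.2) :=
      Partrec.rfindOpt (hΛ.comp (Computable.snd.comp Computable.fst) Computable.snd).to₂
    have h2 : Computable fun p : (List Bool × ℕ) × ℕ =>
        bif decide (p.2 = p.1.1.length) then some (Encodable.encode p.1.1) else none :=
      Computable.cond (Computable.decide_eq Computable.snd
        (Computable.list_length.comp (Computable.fst.comp Computable.fst)))
        (Computable.option_some.comp
          (Computable.encode.comp (Computable.fst.comp Computable.fst))) (Computable.const none)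
    exact h1.bind (Computable.ofOption h2).to₂
  have hΘ_uc : UseConsistent Θ := by
    intro τ τ' k h h' hp
    obtain ⟨y, hy⟩ := Part.dom_iff_mem.1 h
    obtain ⟨y', hy'⟩ := Part.dom_iff_mem.1 h'
    obtain ⟨⟨s, hs⟩, -⟩ := (hΘ_mem _ _ _).1 hy
    obtain ⟨⟨s', hs'⟩, -⟩ := (hΘ_mem _ _ _).1 hy'
    exact hp.eq_of_length ((hΛs k).unique hs hs')
  obtain ⟨h, T, ⟨hh, -⟩, ⟨hTce, hT⟩, hTcard⟩ :=
    hJ (evalAt Θ A) ⟨Θ, hΘ, hΘ_uc, hΘ_uc.evalsTo_evalAt⟩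
  obtain ⟨L, hL, hLpre, hLcard, hLT⟩ := hTce.exists_enumeration
  have hLs : ∀ k n, Staged fun s => (L k s)[n]? := fun k => staged_getElem? (hLpre k)
  let R : List Bool → ℕ → ℕ → Bool := fun τ c s => decide (Λ c.unpair.1 s = some τ.length) &&
    decide ((L c.unpair.1 s)[c.unpair.2]? = some (Encodable.encode τ))
  have hR_iff : ∀ τ c s, R τ c s = true ↔ Λ c.unpair.1 s = some τ.length ∧
      (L c.unpair.1 s)[c.unpair.2]? = some (Encodable.encode τ) := by
    intro τ c s
    simp [R]
  let C : Set ℕ := {c | ∃ k, ∃ s, R (initSeg A k) c s = true}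
  have hC : CeIn A C := by
    refine ⟨fun τ c => (Nat.rfind fun s => Part.some (R τ c s)).map fun _ => (), ?_, fun c => ?_⟩
    · have hk : Computable fun p : (List Bool × ℕ) × ℕ => p.1.2.unpair.1 :=
        Computable.fst.comp (Computable.unpair.comp (Computable.snd.comp Computable.fst))
      have hn : Computable fun p : (List Bool × ℕ) × ℕ => p.1.2.unpair.2 :=
        Computable.snd.comp (Computable.unpair.comp (Computable.snd.comp Computable.fst))
      have hτ : Computable fun p : (List Bool × ℕ) × ℕ => p.1.1 :=
        Computable.fst.comp Computable.fst
      have hR : Computable₂ fun (p : List Bool × ℕ) s => R p.1 p.2 s :=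
        Computable.bool_and
          (Computable.decide_eq (hΛ.comp hk Computable.snd)
            (Computable.option_some.comp (Computable.list_length.comp hτ)))
          (Computable.decide_eq (Computable.list_getElem?.comp (hL.comp hk Computable.snd) hn)
            (Computable.option_some.comp (Computable.encode.comp hτ)))
      exact (Partrec.rfind hR.partrec₂).map (Computable.const ()).to₂
    · refine exists_congr fun k => ⟨?_, fun hd => ?_⟩
      · rintro ⟨s, hs⟩
        exact Nat.rfind_dom.2 ⟨s, by simp [hs], fun _ => trivial⟩
      · obtain ⟨s, hs, -⟩ := Nat.rfind_dom.1 hd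
        obtain ⟨_, hs⟩ := hs
        exact ⟨s, hs⟩
  obtain ⟨g, b, hg, hb, hglim, hgb⟩ := hS C hC
  let w : ℕ → ℕ → ℕ → Option (List Bool) := fun k s n =>
    ((L k s)[n]?.bind Encodable.decode).bind fun σ : List Bool =>
      bif decide (Λ k s = some σ.length) then some σ else none
  let u : ℕ → ℕ → ℕ → Option (List Bool) := fun k s n =>
    bif g (Nat.pair k n) s then w k s n else none
  have hw_iff : ∀ k s n σ, w k s n = some σ ↔ Λ k s = some σ.length ∧
      ∃ e, (L k s)[n]? = some e ∧ Encodable.decode e = some σ := by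
    intro k s n σ
    simp only [w, Option.bind_eq_some_iff, Bool.cond_decide, Option.ite_none_right_eq_some,
      Option.some.injEq]
    constructor
    · rintro ⟨τ, ⟨e, he⟩, hτ, rfl⟩
      exact ⟨hτ, e, he⟩
    · rintro ⟨hσ, e, he⟩
      exact ⟨σ, ⟨e, he⟩, hσ, rfl⟩
  have hu_iff : ∀ k s n σ, u k s n = some σ ↔ g (Nat.pair k n) s = true ∧ w k s n = some σ := by
    intro k s n σ
    simp only [u]
    cases g (Nat.pair k n) s <;> simp
  let cand : ℕ → ℕ → Option (List Bool) := fun k s => firstSome (u k s) (h k)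
  let ρ : ℕ → ℕ → Option (List Bool) := fun k s =>
    Nat.rec (motive := fun _ => Option (List Bool)) (cand k 0)
      (fun s r => (cand k (s + 1) <|> r)) s
  have hρ_succ : ∀ k s, ρ k (s + 1) = (cand k (s + 1) <|> ρ k s) := fun _ _ => rfl
  have hcand : Computable₂ cand := by
    have hk : Computable fun p : (ℕ × ℕ) × ℕ => p.1.1 := Computable.fst.comp Computable.fst
    have hs : Computable fun p : (ℕ × ℕ) × ℕ => p.1.2 := Computable.snd.comp Computable.fst
    have hdec : Computable fun p : (ℕ × ℕ) × ℕ =>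
        (L p.1.1 p.1.2)[p.2]?.bind fun e => (Encodable.decode e : Option (List Bool)) :=
      Computable.option_bind (Computable.list_getElem?.comp (hL.comp hk hs) Computable.snd)
        (Computable.decode.comp Computable.snd).to₂
    have htest : Computable₂ fun (p : (ℕ × ℕ) × ℕ) (σ : List Bool) =>
        bif decide (Λ p.1.1 p.1.2 = some σ.length) then some σ else none :=
      Computable.cond (Computable.decide_eq
        (hΛ.comp (hk.comp Computable.fst) (hs.comp Computable.fst))
        (Computable.option_some.comp (Computable.list_length.comp Computable.snd)))
        (Computable.option_some.comp Computable.snd) (Computable.const none)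
    have hw : Computable fun p : (ℕ × ℕ) × ℕ => w p.1.1 p.1.2 p.2 :=
      Computable.option_bind hdec htest
    have hu : Computable₂ fun (p : ℕ × ℕ) n => u p.1 p.2 n :=
      Computable.cond (hg.comp (Computable.nat_pair hk Computable.snd) hs) hw
        (Computable.const none)
    exact Computable.firstSome hu (hh.comp Computable.fst)
  have hρ : Computable₂ ρ := by
    have hstep : Computable₂ fun (a : ℕ × ℕ) (p : ℕ × Option (List Bool)) =>
        (cand a.1 (p.1 + 1) <|> p.2) :=
      Computable.orElse (hcand.comp (Computable.fst.comp Computable.fst)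
        (Computable.succ.comp (Computable.fst.comp Computable.snd)))
        (Computable.snd.comp Computable.snd)
    exact Computable.nat_rec Computable.snd
      (hcand.comp Computable.fst (Computable.const 0)) hstep
  have hcand_len : ∀ k s σ, cand k s = some σ → Λ k s = some σ.length := by
    intro k s σ hσ
    obtain ⟨n, -, hn⟩ := exists_of_firstSome hσ
    exact ((hw_iff _ _ _ _).1 ((hu_iff _ _ _ _).1 hn).2).1
  refine ⟨ρ, fun k => ∑ n ∈ Finset.range (h k), (b (Nat.pair k n) + 1 + 1), hρ, ?_, ?_, ?_, ?_, ?_⟩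
  · exact Computable.sum_range (Computable.succ.comp (Computable.succ.comp
      (hb.comp (Computable.nat_pair Computable.fst Computable.snd)))).to₂ hh
  · intro k s
    induction s with
    | zero => exact fun σ hσ => ⟨0, hcand_len k 0 σ hσ⟩
    | succ s ih =>
      intro σ hσ
      rw [hρ_succ] at hσ
      cases hc : cand k (s + 1) with
      | none => exact ih σ (by simpa [hc] using hσ)
      | some τ => exact ⟨s + 1, hcand_len k _ σ (by simpa [hc] using hσ)⟩
  · intro k s hs
    rw [hρ_succ]
    cases hc : cand k (s + 1) <;> simp [hs]
  · intro k s₁ l hl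
    have hlT : Encodable.encode (initSeg A l) ∈ T k := by
      refine hT k _ ((hΘ_uc.evalsTo_evalAt k _).2 ⟨l, (hΘ_mem _ _ _).2 ⟨⟨s₁, ?_⟩, rfl⟩⟩)
      rw [hl, length_initSeg]
    obtain ⟨s₂, hs₂⟩ := (hLT k _).1 hlT
    obtain ⟨n₀, hn₀⟩ := List.mem_iff_getElem?.1 hs₂
    have hn₀h : n₀ < h k := (List.getElem?_eq_some_iff.1 hn₀).1.trans_le
      ((hLcard k s₂).trans (hTcard k))
    have hev : ∀ n ∈ Finset.range (h k), ∀ᶠ s in Filter.atTop,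
        (g (Nat.pair k n) s = true ↔ Nat.pair k n ∈ C) := fun n _ =>
      Filter.eventually_atTop.2 (hglim _)
    obtain ⟨s₃, hs₃⟩ := Filter.eventually_atTop.1 ((Filter.eventually_all_finset _).2 hev)
    have hcand_eq : ∀ s ≥ max s₁ (max s₂ s₃), cand k s = some (initSeg A l) := by
      intro s hs
      have h1 : s₁ ≤ s := le_of_max_le_left hs
      have h2 : s₂ ≤ s := le_of_max_le_left (le_of_max_le_right hs)
      have h3 : s₃ ≤ s := le_of_max_le_right (le_of_max_le_right hs)
      have hLs' := (hLs k n₀).le h2 hn₀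
      have hΛl := (hΛs k).le h1 hl
      refine firstSome_eq_of_unique hn₀h ?_ fun n hn σ hσ => ?_
      · refine Option.isSome_iff_exists.2 ⟨initSeg A l, (hu_iff _ _ _ _).2 ⟨?_, ?_⟩⟩
        · refine (hs₃ s h3 n₀ (Finset.mem_range.2 hn₀h)).2 ⟨l, s, (hR_iff _ _ _).2 ?_⟩
          simpa using ⟨hΛl, hLs'⟩
        · exact (hw_iff _ _ _ _).2 ⟨by simpa using hΛl, _, hLs', Encodable.encodek _⟩
      · obtain ⟨hgs, hw⟩ := (hu_iff _ _ _ _).1 hσ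
        obtain ⟨-, e, he, heσ⟩ := (hw_iff _ _ _ _).1 hw
        obtain ⟨j, t, hR⟩ := (hs₃ s h3 n (Finset.mem_range.2 hn)).1 hgs
        obtain ⟨hj, hjL⟩ := (hR_iff _ _ _).1 hR
        simp only [Nat.unpair_pair, length_initSeg] at hj hjL
        obtain rfl := (hΛs k).unique hl hj
        rw [(hLs k n).unique he hjL, Encodable.encodek] at heσ
        exact (Option.some.inj heσ).symm
    refine ⟨max s₁ (max s₂ s₃) + 1, fun s hs => ?_⟩
    obtain ⟨s, rfl⟩ : ∃ t, s = t + 1 := ⟨s - 1, by omega⟩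
    rw [hρ_succ, hcand_eq (s + 1) (by omega)]
    rfl
  · intro k
    refine (HappensAtMost.exists_lt (fun n => (HappensAtMost.or (HappensAtMost.or
      (hgb (Nat.pair k n)) (hLs k n).happensAtMost) (hΛs k).happensAtMost)) (h k)).mono ?_
    intro s hne
    by_contra! hcon
    have hcc : cand k (s + 1) = cand k s := by
      refine firstSome_congr fun n hn => ?_
      obtain ⟨⟨hg', hL'⟩, hΛ'⟩ := hcon n hn
      simp only [u, w, hg', hL', hΛ']
    refine hne ?_
    rw [hρ_succ, hcc]
    cases hc : cand k s with
    | none => simp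
    | some σ =>
      cases s with
      | zero => rw [show ρ k 0 = cand k 0 from rfl, hc]; rfl
      | succ s => simp [hρ_succ, hc]

end Guess

section Approximation

variable {A : ℕ → Bool}

theorem Superlow.exists_approx (hS : Superlow A) : ∃ B : ℕ → ℕ → Bool, Computable₂ B ∧
    ∀ m, ∃ s₀, ∀ s ≥ s₀, B s m = A m := by
  have hce : CeIn A {m : ℕ | A m = true} := by
    refine ⟨fun τ m => ((bif decide (τ[m]? = some true) then some () else none : Option Unit) :
      Part Unit), Computable.ofOption (Computable.cond (Computable.decide_eq
        (Computable.list_getElem?.comp Computable.fst Computable.snd) (Computable.const _))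
        (Computable.const _) (Computable.const _)), fun m => ?_⟩
    simp only [Set.mem_ofPred_eq, getElem?_initSeg]
    constructor
    · intro hm
      exact ⟨m + 1, by simp [hm]⟩
    · rintro ⟨k, hk⟩
      by_contra hm
      by_cases hmk : m < k <;> simp [hm, hmk] at hk
  obtain ⟨g, -, hg, -, hglim, -⟩ := hS _ hce
  refine ⟨fun s m => g m s, hg.comp Computable.snd Computable.fst, fun m => ?_⟩
  obtain ⟨s₀, hs₀⟩ := hglim m
  exact ⟨s₀, fun s hs => Bool.eq_iff_iff.2 (hs₀ s hs)⟩

theorem restrainedApprox_of_superlow_of_jumpTraceable (hS : Superlow A) (hJ : JumpTraceable A)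
    {ψ : ℕ →. ℕ} (hψ : APartialComputable A ψ) : RestrainedApprox A ψ := by
  obtain ⟨Γ₀, hΓ₀, hΓ₀_uc, hev⟩ := hψ
  let Θ : List Bool → ℕ →. ℕ := fun τ x => (Γ₀ τ x).map fun _ => Encodable.encode τ
  have hΘ : Partrec₂ Θ := Partrec.map hΓ₀
    (Computable.encode.comp (Computable.fst.comp Computable.fst)).to₂
  have hΘ_uc : UseConsistent Θ := hΓ₀_uc
  obtain ⟨h, T, ⟨hh, -⟩, ⟨hTce, hT⟩, hTcard⟩ :=
    hJ (evalAt Θ A) ⟨Θ, hΘ, hΘ_uc, hΘ_uc.evalsTo_evalAt⟩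
  obtain ⟨L, hL, hLpre, hLcard, hLT⟩ := hTce.exists_enumeration
  let Λ : ℕ → ℕ → Option ℕ := fun c s =>
    ((L c.unpair.1 s)[c.unpair.2]?.bind fun e => (Encodable.decode e : Option (List Bool))).map
      List.length
  have hΛ : Computable₂ Λ := by
    have hk : Computable fun p : ℕ × ℕ => p.1.unpair.1 :=
      Computable.fst.comp (Computable.unpair.comp Computable.fst)
    have hn : Computable fun p : ℕ × ℕ => p.1.unpair.2 :=
      Computable.snd.comp (Computable.unpair.comp Computable.fst)
    exact Computable.option_map (Computable.option_bind (Computable.list_getElem?.comp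
      (hL.comp hk Computable.snd) hn) (Computable.decode.comp Computable.snd).to₂)
      (Computable.list_length.comp Computable.snd).to₂
  have hΛs : ∀ c, Staged (Λ c) := by
    intro c s l hl
    simp only [Λ, Option.map_eq_some_iff, Option.bind_eq_some_iff] at hl ⊢
    obtain ⟨σ, ⟨e, he, hσ⟩, hl⟩ := hl
    exact ⟨σ, ⟨e, staged_getElem? (hLpre _) _ _ _ he, hσ⟩, hl⟩
  have hΛ_of : ∀ x n s τ, (L x s)[n]? = some (Encodable.encode τ) →
      Λ (Nat.pair x n) s = some (List.length (α := Bool) τ) := by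
    intro x n s τ he
    simp [Λ, he]
  obtain ⟨ρ, b, hρ, hb, hρ_len, hρ_isSome, hρ_lim, hρ_bd⟩ := exists_guess hS hJ hΛ hΛs
  obtain ⟨B, hB, hBlim⟩ := hS.exists_approx
  obtain ⟨G, hG, hGs, hGΓ⟩ := Partrec.exists_staged hΓ₀
  let v : ℕ → ℕ → ℕ → Option Bool := fun s m k => (ρ k s).bind fun σ => σ[m]?
  let As : ℕ → ℕ → Bool := fun s m => (firstSome (v s m) s).getD (B s m)
  have hAs : Computable₂ As := by
    have hv : Computable₂ fun (p : ℕ × ℕ) k => v p.1 p.2 k :=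
      Computable.option_bind
        (hρ.comp Computable.snd (Computable.fst.comp Computable.fst))
        (Computable.list_getElem?.comp Computable.snd
          (Computable.snd.comp (Computable.fst.comp Computable.fst))).to₂
    exact Computable.option_getD (Computable.firstSome hv Computable.fst)
      (hB.comp Computable.fst Computable.snd)
  let I : ℕ → List Bool → ℕ → ℕ := fun s τ x => (L x s).idxOf (Encodable.encode τ)
  have hI : ∀ s τ x, Encodable.encode τ ∈ L x s → I (s + 1) τ x = I s τ x := by
    intro s τ x hmem
    obtain ⟨l, hl⟩ := hLpre x s
    simp only [I, ← hl, List.idxOf_append_of_mem hmem]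
  let Γs : ℕ × List Bool × ℕ → Option ℕ := fun p =>
    bif decide (I p.1 p.2.1 p.2.2 < (L p.2.2 p.1).length) &&
        (decide (Nat.pair p.2.2 (I p.1 p.2.1 p.2.2) < p.1) &&
          (ρ (Nat.pair p.2.2 (I p.1 p.2.1 p.2.2)) p.1).isSome)
      then G p.2 p.1 else none
  have hΓs : Computable Γs := by
    have hx : Computable fun p : ℕ × List Bool × ℕ => p.2.2 := Computable.snd.comp Computable.snd
    have hLp : Computable fun p : ℕ × List Bool × ℕ => L p.2.2 p.1 := hL.comp hx Computable.fst
    have hIp : Computable fun p : ℕ × List Bool × ℕ => I p.1 p.2.1 p.2.2 :=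
      Primrec.list_idxOf.to_comp.comp
        (Computable.encode.comp (Computable.fst.comp Computable.snd)) hLp
    have hpair := Computable.nat_pair hx hIp
    exact Computable.cond (Computable.bool_and
      (Computable.decide_lt hIp (Computable.list_length.comp hLp))
      (Computable.bool_and (Computable.decide_lt hpair Computable.fst)
        (Computable.isSome (hρ.comp hpair Computable.fst))))
      (hG.comp Computable.snd Computable.fst) (Computable.const none)
  have hΓs_iff : ∀ s τ x y, Γs (s, τ, x) = some y ↔ Encodable.encode τ ∈ L x s ∧
      Nat.pair x (I s τ x) < s ∧ (ρ (Nat.pair x (I s τ x)) s).isSome ∧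
        G (τ, x) s = some y := by
    intro s τ x y
    rw [← List.idxOf_lt_length_iff]
    simp only [Γs]
    by_cases h1 : I s τ x < (L x s).length
    · by_cases h2 : Nat.pair x (I s τ x) < s
      · cases h3 : (ρ (Nat.pair x (I s τ x)) s).isSome <;> simp [h1, h2, I]
      · simp [h2]
    · simp only [h1, decide_false, Bool.false_and, cond_false, reduceCtorEq, false_iff]
      exact fun hc => h1 hc.1
  have hΓs_staged : ∀ τ x, Staged fun s => Γs (s, τ, x) := by
    intro τ x s y hy
    obtain ⟨h1, h2, h3, h4⟩ := (hΓs_iff _ _ _ _).1 hy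
    refine (hΓs_iff _ _ _ _).2 ⟨(hLpre x s).subset h1, ?_, ?_, hGs _ _ _ h4⟩
    · rw [hI _ _ _ h1]
      omega
    · rw [hI _ _ _ h1]
      exact hρ_isSome _ _ h3
  have hΓ_mem : ∀ τ x y, y ∈ Nat.rfindOpt (fun s => Γs (s, τ, x)) ↔ ∃ s, Γs (s, τ, x) = some y :=
    fun τ x y => (hΓs_staged τ x).mem_rfindOpt
  have hΓ_sub : ∀ τ x y, y ∈ Nat.rfindOpt (fun s => Γs (s, τ, x)) → y ∈ Γ₀ τ x := by
    intro τ x y hy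
    obtain ⟨s, hs⟩ := (hΓ_mem _ _ _).1 hy
    exact (hGΓ (τ, x) y).2 ⟨s, ((hΓs_iff _ _ _ _).1 hs).2.2.2⟩
  refine ⟨As, Γs, fun τ x => Nat.rfindOpt fun s => Γs (s, τ, x),
    fun x => ∑ n ∈ Finset.range (h x), ∑ j ∈ Finset.range (Nat.pair x n + 1), b j,
    hAs, hΓs, ?_, ?_, fun s τ x y => hΓs_staged τ x s y, hΓ_mem, ?_, ?_, ?_⟩
  · refine Computable.sum_range ?_ hh
    refine Computable.sum_range (hb.comp Computable.snd) ?_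
    exact Computable.succ.comp (Computable.nat_pair Computable.fst Computable.snd)
  · intro m
    obtain ⟨s₁, hs₁⟩ := hBlim m
    by_cases hk : ∃ k s l, Λ k s = some l ∧ m < l
    · obtain ⟨k, s, l, hl, hml⟩ := hk
      obtain ⟨s₂, hs₂⟩ := hρ_lim k s l hl
      have hev : ∀ j ∈ Finset.range k, ∀ᶠ s in Filter.atTop,
          ∀ z, v s m j = some z → z = A m := by
        intro j _
        obtain ⟨s₃, hs₃⟩ := (hρ_bd j).eventually_const
        refine Filter.eventually_atTop.2 ?_
        cases hj : ρ j s₃ with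
        | none => exact ⟨s₃, fun s hs z hz => by simp [v, hs₃ s hs, hj] at hz⟩
        | some σ =>
          obtain ⟨t, ht⟩ := hρ_len j s₃ σ hj
          obtain ⟨s₄, hs₄⟩ := hρ_lim j t _ ht
          refine ⟨s₄, fun s hs z hz => ?_⟩
          simp only [v, hs₄ s hs, Option.bind_some, getElem?_initSeg] at hz
          split_ifs at hz
          exact (Option.some.inj hz).symm
      refine Filter.eventually_atTop.1 ?_
      filter_upwards [(Filter.eventually_all_finset _).2 hev, Filter.eventually_ge_atTop s₂,
        Filter.eventually_ge_atTop (k + 1)] with s hs hs2 hsk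
      have hvk : v s m k = some (A m) := by
        simp only [v, hs₂ s hs2, Option.bind_some, getElem?_initSeg, hml, if_true]
      have hfs : firstSome (v s m) (k + 1) = some (A m) := by
        refine firstSome_eq_of_unique (Nat.lt_succ_self k) (by simp [hvk]) fun j hj z hz => ?_
        rcases Nat.lt_succ_iff_lt_or_eq.1 hj with hj | rfl
        · exact hs j (Finset.mem_range.2 hj) z hz
        · exact (Option.some.inj (hvk.symm.trans hz)).symm
      simp only [As, firstSome_eq_of_le hsk (by simp [hfs] : (firstSome (v s m) (k + 1)).isSome),
        hfs, Option.getD_some]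
    · refine ⟨s₁, fun s hs => ?_⟩
      have hnone : firstSome (v s m) s = none := by
        rw [Option.eq_none_iff_forall_ne_some]
        intro z hz
        obtain ⟨k, -, hkz⟩ := exists_of_firstSome hz
        obtain ⟨σ, hσ, hσz⟩ := Option.bind_eq_some_iff.1 hkz
        obtain ⟨t, ht⟩ := hρ_len k s σ hσ
        exact hk ⟨k, t, _, ht, (List.getElem?_eq_some_iff.1 hσz).1⟩
      simp only [As, hnone, Option.getD_none, hs₁ s hs]
  · intro τ τ' x hd hd'
    obtain ⟨y, hy⟩ := Part.dom_iff_mem.1 hd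
    obtain ⟨y', hy'⟩ := Part.dom_iff_mem.1 hd'
    exact hΓ₀_uc τ τ' x (Part.dom_iff_mem.2 ⟨y, hΓ_sub _ _ _ hy⟩)
      (Part.dom_iff_mem.2 ⟨y', hΓ_sub _ _ _ hy'⟩)
  · intro x y
    rw [hev]
    refine exists_congr fun k => ⟨fun hy => ?_, hΓ_sub _ _ _⟩
    have hmem : Encodable.encode (initSeg A k) ∈ T x := by
      refine hT x _ ((hΘ_uc.evalsTo_evalAt x _).2 ⟨k, ?_⟩)
      exact Part.mem_map _ hy
    obtain ⟨s₁, hs₁⟩ := (hLT x _).1 hmem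
    have hIs : ∀ s ≥ s₁, Encodable.encode (initSeg A k) ∈ L x s ∧
        I s (initSeg A k) x = I s₁ (initSeg A k) x := by
      intro s hs
      induction s, hs using Nat.le_induction with
      | base => exact ⟨hs₁, rfl⟩
      | succ s _ ih => exact ⟨(hLpre x s).subset ih.1, (hI _ _ _ ih.1).trans ih.2⟩
    obtain ⟨s₂, hs₂⟩ := hρ_lim _ s₁ _
      (hΛ_of x (I s₁ (initSeg A k) x) s₁ _ (List.getElem?_idxOf hs₁))
    obtain ⟨s₃, hs₃⟩ := (hGΓ (initSeg A k, x) y).1 hy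
    obtain ⟨s, hs⟩ : ∃ s, s₁ ≤ s ∧ s₂ ≤ s ∧ s₃ ≤ s ∧
        Nat.pair x (I s₁ (initSeg A k) x) < s :=
      ⟨s₁ + s₂ + s₃ + Nat.pair x (I s₁ (initSeg A k) x) + 1, by omega⟩
    refine (hΓ_mem _ _ _).2 ⟨s, (hΓs_iff _ _ _ _).2 ⟨(hIs s hs.1).1, ?_, ?_,
      (hGs _).le hs.2.2.1 hs₃⟩⟩
    · rw [(hIs s hs.1).2]
      exact hs.2.2.2
    · rw [(hIs s hs.1).2, hs₂ s hs.2.1]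
      rfl
  · intro x
    refine (HappensAtMost.exists_lt (fun n => HappensAtMost.exists_lt hρ_bd (Nat.pair x n + 1))
      (h x)).mono ?_
    rintro s ⟨τ, y, hy, hτ, hne⟩
    obtain ⟨h1, h2, h3, -⟩ := (hΓs_iff _ _ _ _).1 hy
    refine ⟨I s τ x, ?_, ?_⟩
    · exact (List.idxOf_lt_length_iff.2 h1).trans_le ((hLcard x s).trans (hTcard x))
    by_contra! hcon
    obtain ⟨σ, hσ⟩ := Option.isSome_iff_exists.1 h3
    obtain ⟨t, ht⟩ := hρ_len _ _ _ hσ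
    have hlen : σ.length = τ.length :=
      (hΛs _).unique ht (hΛ_of x (I s τ x) s τ (List.getElem?_idxOf h1))
    refine hne (Eq.trans (initSeg_eq_iff.2 fun m hm => ?_) hτ)
    have hfs : firstSome (v (s + 1) m) (Nat.pair x (I s τ x) + 1) =
        firstSome (v s m) (Nat.pair x (I s τ x) + 1) :=
      firstSome_congr fun j hj => by simp only [v, hcon j hj]
    have hsome : (firstSome (v s m) (Nat.pair x (I s τ x) + 1)).isSome := by
      refine isSome_firstSome (Nat.lt_succ_self _) ?_
      simp [v, hσ, hlen, hm]
    simp only [As]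
    rw [firstSome_eq_of_le h2 hsome, firstSome_eq_of_le (h2.trans (Nat.lt_succ_self s))
      (hfs ▸ hsome), hfs]
    obtain ⟨z, hz⟩ := Option.isSome_iff_exists.1 hsome
    simp [hz]

end Approximation

/-- A set `A` is superlow and jump-traceable if and only if every `A`-partial
computable function has a restrained `A`-approximation. -/
theorem stmt9 (A : ℕ → Bool) :
    (Superlow A ∧ JumpTraceable A) ↔
      ∀ ψ : ℕ →. ℕ, APartialComputable A ψ → RestrainedApprox A ψ :=
  ⟨fun h _ hψ => restrainedApprox_of_superlow_of_jumpTraceable h.1 h.2 hψ,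
    fun h => ⟨superlow_of_restrainedApprox h, jumpTraceable_of_restrainedApprox h⟩⟩
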